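/- (Kato's inequality) Let {χ^(i)}_{i=1}^n be {0,1}-valued random variables adapted to a filtration {F^(i)}_{i=0}^n, and let S_n := Σ_{i=1}^n E[χ^(i) | F^(i−1)] and N_n := Σ_{i=1}^n χ^(i). Then for any a ∈ ℝ and any b ≥ |a|, Pr[ S_n ≥ N_n + ( b + a(2N_n/n − 1) )·√n ] ≤ exp( −(2b² − 2a²) / (1 + 4a/(3√n))² ). -/

import Mathlib

open MeasureTheory Finset

/-- A lower bound for the binary relative entropy of `x` with respect to `x + D`. With
`z = 2 * x - 1 + 4 * D / 3`, the function
`m ↦ 4 * m * D - 2 * m ^ 2 * (1 - z ^ 2)` is maximal at `m = D / (1 - z ^ 2)`, so this is a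
refinement of Pinsker's inequality. -/
lemma refined_pinsker {x D : ℝ} (m : ℝ) (hx0 : 0 < x) (hx1 : x < 1) (hp0 : 0 < x + D)
    (hp1 : x + D < 1) :
    4 * m * D - 2 * m ^ 2 * (1 - (2 * x - 1 + 4 * D / 3) ^ 2) ≤
      x * Real.log x + (1 - x) * Real.log (1 - x) - x * Real.log (x + D)
        - (1 - x) * Real.log (1 - (x + D)) := by
  have hu0 : ∀ s ∈ Set.Icc (0 : ℝ) 1, 0 < x + s * D := fun s hs => by
    rcases le_total 0 D with hD | hD <;> nlinarith [hs.1, hs.2]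
  have hu1 : ∀ s ∈ Set.Icc (0 : ℝ) 1, 0 < 1 - (x + s * D) := fun s hs => by
    rcases le_total 0 D with hD | hD <;> nlinarith [hs.1, hs.2]
  set φ : ℝ → ℝ := fun s => - x * Real.log (x + s * D) - (1 - x) * Real.log (1 - (x + s * D))
    - (4 * m * D * s ^ 2 - 16 * m ^ 2 * (x * (1 - x) / 2 * s ^ 2 + D * (1 - 2 * x) / 3 * s ^ 3
      - D ^ 2 / 4 * s ^ 4)) with hφ
  have hderiv : ∀ s ∈ Set.Icc (0 : ℝ) 1, HasDerivAt φ
      (s * (D - 4 * m * ((x + s * D) * (1 - (x + s * D)))) ^ 2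
        / ((x + s * D) * (1 - (x + s * D)))) s := by
    intro s hs
    have h0 := hu0 s hs
    have h1 := hu1 s hs
    have hl : HasDerivAt (fun s : ℝ => x + s * D) D s := by
      simpa using ((hasDerivAt_id s).mul_const D).const_add x
    have hpoly : HasDerivAt (fun s : ℝ => 4 * m * D * s ^ 2 - 16 * m ^ 2 *
        (x * (1 - x) / 2 * s ^ 2 + D * (1 - 2 * x) / 3 * s ^ 3 - D ^ 2 / 4 * s ^ 4)) _ s :=
      ((hasDerivAt_pow 2 s).const_mul (4 * m * D)).sub
        (((((hasDerivAt_pow 2 s).const_mul (x * (1 - x) / 2)).add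
          ((hasDerivAt_pow 3 s).const_mul (D * (1 - 2 * x) / 3))).sub
          ((hasDerivAt_pow 4 s).const_mul (D ^ 2 / 4))).const_mul (16 * m ^ 2))
    have h := (((hl.log h0.ne').const_mul (-x)).sub
      (((hl.const_sub 1).log h1.ne').const_mul (1 - x))).sub hpoly
    refine h.congr_deriv ?_
    generalize hu : x + s * D = u at h0 h1 ⊢
    obtain rfl : x = u - s * D := by linarith
    have h0' := h0.ne'
    have h1' := h1.ne'
    push_cast
    field_simp
    ring
  have hmono : MonotoneOn φ (Set.Icc 0 1) := by
    refine monotoneOn_of_deriv_nonneg (convex_Icc 0 1)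
      (fun s hs => (hderiv s hs).continuousAt.continuousWithinAt)
      (fun s hs => (hderiv s (interior_subset hs)).differentiableAt.differentiableWithinAt) ?_
    intro s hs
    have hs' := interior_subset hs
    rw [(hderiv s hs').deriv]
    have := hu0 s hs'
    have := hu1 s hs'
    have := hs'.1
    positivity
  have h := hmono (Set.left_mem_Icc.2 zero_le_one) (Set.right_mem_Icc.2 zero_le_one) zero_le_one
  simp only [hφ, zero_mul, one_mul, add_zero, one_pow, mul_one] at h
  nlinarith [sq_nonneg (m * D)]

/-- A bound, uniform in `p`, for the moment generating function at `4 * β / k ^ 2` of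
`p - (1 + 2 * α) * X`, where `X` is a Bernoulli variable of parameter `p` and
`k = 1 + 4 * α / 3`. -/
lemma bernoulli_mgf_le {α β p t : ℝ} (hk : 1 + 4 * α / 3 ≠ 0)
    (ht : t = 4 * β / (1 + 4 * α / 3) ^ 2) (hp0 : 0 ≤ p) (hp1 : p ≤ 1) :
    Real.exp (t * p) * (1 - (1 - Real.exp (-(t * (1 + 2 * α)))) * p) ≤
      Real.exp (2 * (β - α) ^ 2 / (1 + 4 * α / 3) ^ 2) := by
  set k := 1 + 4 * α / 3 with hkdef
  have hα : α = 3 * (k - 1) / 4 := by rw [hkdef]; ring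
  rcases hp0.eq_or_lt with rfl | hp0
  · simp only [mul_zero, Real.exp_zero, sub_zero, mul_one]
    exact Real.one_le_exp (by positivity)
  rcases hp1.eq_or_lt with rfl | hp1
  · rw [mul_one, mul_one, sub_sub_cancel, ← Real.exp_add, Real.exp_le_exp]
    have h : 2 * (β - α) ^ 2 / k ^ 2 - (t + -(t * (1 + 2 * α))) = 2 * (β + α) ^ 2 / k ^ 2 := by
      rw [ht]; field_simp; ring
    have : 0 ≤ 2 * (β + α) ^ 2 / k ^ 2 := by positivity
    linarith
  set E := Real.exp (-(t * (1 + 2 * α))) with hE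
  have hEpos : 0 < E := Real.exp_pos _
  have hq : 0 < 1 - p := by linarith
  set Z := 1 - (1 - E) * p with hZ
  have hZeq : Z = (1 - p) + p * E := by rw [hZ]; ring
  have hZpos : 0 < Z := by rw [hZeq]; positivity
  -- The exponentially tilted parameter.
  set x := p * E / Z with hx
  have hx0 : 0 < x := by positivity
  have hx1' : 1 - x = (1 - p) / Z := by rw [hx]; field_simp; rw [hZeq]; ring
  have hx1 : 0 < 1 - x := by rw [hx1']; positivity
  have hkl := refined_pinsker (x := x) (D := p - x) (β / k) hx0 (by linarith) (by linarith)
    (by linarith)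
  have hlogE : Real.log E = -(t * (1 + 2 * α)) := Real.log_exp _
  have hlogx : Real.log x = Real.log p - t * (1 + 2 * α) - Real.log Z := by
    rw [hx, Real.log_div (by positivity) hZpos.ne', Real.log_mul hp0.ne' hEpos.ne', hlogE]; ring
  have hlogx1 : Real.log (1 - x) = Real.log (1 - p) - Real.log Z := by
    rw [hx1', Real.log_div hq.ne' hZpos.ne']
  rw [add_sub_cancel, hlogx, hlogx1] at hkl
  rw [← Real.exp_log hZpos, ← Real.exp_add, Real.exp_le_exp]
  have hsq : 4 * (β / k) * (p - x) - 2 * (β / k) ^ 2 * (1 - (2 * x - 1 + 4 * (p - x) / 3) ^ 2)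
      - (t * p - t * (1 + 2 * α) * x - 2 * (β - α) ^ 2 / k ^ 2)
      = 2 * (β * (2 * x - 1 + 4 * (p - x) / 3) + α) ^ 2 / k ^ 2 := by
    rw [ht, hα]; field_simp; ring
  have : 0 ≤ 2 * (β * (2 * x - 1 + 4 * (p - x) / 3) + α) ^ 2 / k ^ 2 := by positivity
  linarith

lemma integrable_of_mem_zero_one {Ω : Type*} {m0 : MeasurableSpace Ω}
    {μ : Measure Ω} [IsProbabilityMeasure μ]
    {X : Ω → ℝ} (hX : AEStronglyMeasurable X μ)
    (h01 : ∀ ω, X ω = 0 ∨ X ω = 1) : Integrable X μ :=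
  Integrable.of_bound hX 1 (.of_forall fun ω => by rcases h01 ω with h | h <;> simp [h])

lemma condExp_mem_Icc {Ω : Type*} {m m0 : MeasurableSpace Ω}
    {μ : Measure Ω} [IsProbabilityMeasure μ]
    {X : Ω → ℝ} (hm : m ≤ m0)
    (hX : AEStronglyMeasurable X μ) (h01 : ∀ ω, X ω = 0 ∨ X ω = 1) :
    ∀ᵐ ω ∂μ, μ[X | m] ω ∈ Set.Icc (0 : ℝ) 1 := by
  have hint := integrable_of_mem_zero_one hX h01
  have h0 : 0 ≤ᵐ[μ] μ[X | m] :=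
    condExp_nonneg (.of_forall fun ω => by rcases h01 ω with h | h <;> simp [h])
  have h1 : μ[X | m] ≤ᵐ[μ] μ[fun _ => (1 : ℝ) | m] :=
    condExp_mono hint (integrable_const 1)
      (.of_forall fun ω => by rcases h01 ω with h | h <;> simp [h])
  rw [condExp_const hm] at h1
  filter_upwards [h0, h1] with ω h0 h1 using ⟨h0, h1⟩

/-- Exponential moments of the compensated sums of a `{0,1}`-valued adapted process: a bound
uniform in the parameter of a Bernoulli variable carries over to sums of conditional ones. -/
lemma integral_exp_sum_condExp_le {Ω : Type*} {m0 : MeasurableSpace Ω}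
    {μ : Measure Ω} [IsProbabilityMeasure μ]
    {n : ℕ} {ℱ : Filtration ℕ m0} {χ : ℕ → Ω → ℝ}
    (hadp : ∀ i, 1 ≤ i → i ≤ n → StronglyMeasurable[ℱ i] (χ i))
    (h01 : ∀ i ω, χ i ω = 0 ∨ χ i ω = 1) {t c g : ℝ}
    (hg : ∀ p ∈ Set.Icc (0 : ℝ) 1,
      Real.exp (t * p) * (1 - (1 - Real.exp (-(t * c))) * p) ≤ Real.exp g)
    (j : ℕ) (hj : j ≤ n) :
    Integrable (fun ω => Real.exp (t * ∑ i ∈ Icc 1 j, (μ[χ i | ℱ (i - 1)] ω - c * χ i ω))) μ ∧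
    ∫ ω, Real.exp (t * ∑ i ∈ Icc 1 j, (μ[χ i | ℱ (i - 1)] ω - c * χ i ω)) ∂μ ≤
      Real.exp (j * g) := by
  induction j with
  | zero => simp
  | succ j ih =>
    obtain ⟨ihint, ihle⟩ := ih (by lia)
    set W : Ω → ℝ := fun ω =>
      Real.exp (t * ∑ i ∈ Icc 1 j, (μ[χ i | ℱ (i - 1)] ω - c * χ i ω)) with hW
    set P : Ω → ℝ := μ[χ (j + 1) | ℱ j] with hP
    set q := 1 - Real.exp (-(t * c)) with hq
    have hχm : AEStronglyMeasurable (χ (j + 1)) μ :=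
      ((hadp (j + 1) (by lia) hj).mono (ℱ.le _)).aestronglyMeasurable
    have hχint := integrable_of_mem_zero_one hχm (h01 (j + 1))
    have hPm : StronglyMeasurable[ℱ j] P := stronglyMeasurable_condExp
    have hPI : ∀ᵐ ω ∂μ, P ω ∈ Set.Icc (0 : ℝ) 1 := condExp_mem_Icc (ℱ.le j) hχm (h01 (j + 1))
    have hWm : StronglyMeasurable[ℱ j] W := by
      refine Real.continuous_exp.comp_stronglyMeasurable (StronglyMeasurable.const_mul ?_ t)
      refine Finset.stronglyMeasurable_fun_sum _ fun i hi => ?_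
      rw [Finset.mem_Icc] at hi
      exact (stronglyMeasurable_condExp.mono (ℱ.mono (by lia))).sub
        (((hadp i hi.1 (by lia)).mono (ℱ.mono hi.2)).const_mul c)
    have hexpm : StronglyMeasurable[ℱ j] fun ω => Real.exp (t * P ω) :=
      Real.continuous_exp.comp_stronglyMeasurable (hPm.const_mul t)
    have hVm : StronglyMeasurable[ℱ j] fun ω => W ω * Real.exp (t * P ω) := hWm.mul hexpm
    have hVint : Integrable (fun ω => W ω * Real.exp (t * P ω)) μ := by
      refine ihint.mul_bdd (c := Real.exp |t|) (hexpm.mono (ℱ.le j)).aestronglyMeasurable ?_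
      filter_upwards [hPI] with ω hω
      rw [Real.norm_eq_abs, Real.abs_exp, Real.exp_le_exp]
      refine (le_abs_self _).trans ?_
      rw [abs_mul, abs_of_nonneg hω.1]
      exact mul_le_of_le_one_right (abs_nonneg t) hω.2
    have hVχint : Integrable ((fun ω => W ω * Real.exp (t * P ω)) * χ (j + 1)) μ := by
      refine hVint.mul_bdd (c := 1) hχm (.of_forall fun ω => ?_)
      rcases h01 (j + 1) ω with h | h <;> simp [h]
    have hVPint : Integrable ((fun ω => W ω * Real.exp (t * P ω)) * P) μ := by
      refine hVint.mul_bdd (c := 1) (hPm.mono (ℱ.le j)).aestronglyMeasurable ?_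
      filter_upwards [hPI] with ω hω
      rw [Real.norm_eq_abs, abs_of_nonneg hω.1]
      exact hω.2
    have hpull : ∫ ω, ((fun ω => W ω * Real.exp (t * P ω)) * χ (j + 1)) ω ∂μ =
        ∫ ω, ((fun ω => W ω * Real.exp (t * P ω)) * P) ω ∂μ := by
      rw [← integral_condExp (ℱ.le j)]
      exact integral_congr_ae (condExp_mul_of_stronglyMeasurable_left hVm hVχint hχint)
    have hsplit : (fun ω =>
        Real.exp (t * ∑ i ∈ Icc 1 (j + 1), (μ[χ i | ℱ (i - 1)] ω - c * χ i ω))) =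
        fun ω => W ω * Real.exp (t * P ω) -
          q * ((fun ω => W ω * Real.exp (t * P ω)) * χ (j + 1)) ω := by
      funext ω
      rw [Finset.sum_Icc_succ_top (by lia), mul_add, Real.exp_add, Nat.add_sub_cancel, ← hP,
        mul_sub, sub_eq_add_neg, Real.exp_add, Pi.mul_apply]
      rcases h01 (j + 1) ω with h | h
      · simp [h, hW]
      · simp only [h, hW, hq, mul_one]; ring
    rw [hsplit]
    refine ⟨hVint.sub (hVχint.const_mul q), ?_⟩
    rw [integral_sub hVint (hVχint.const_mul q), integral_const_mul, hpull, ← integral_const_mul,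
      ← integral_sub hVint (hVPint.const_mul q)]
    calc ∫ ω, W ω * Real.exp (t * P ω) -
          q * ((fun ω => W ω * Real.exp (t * P ω)) * P) ω ∂μ
        ≤ ∫ ω, W ω * Real.exp g ∂μ := by
          refine integral_mono_ae (hVint.sub (hVPint.const_mul q)) (ihint.mul_const _) ?_
          filter_upwards [hPI] with ω hω
          have := mul_le_mul_of_nonneg_left (hg (P ω) hω) (Real.exp_pos _ : 0 < W ω).le
          simp only [Pi.mul_apply]
          linarith
      _ = (∫ ω, W ω ∂μ) * Real.exp g := integral_mul_const _ _
      _ ≤ Real.exp (j * g) * Real.exp g := by gcongr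
      _ = Real.exp ((j + 1 : ℕ) * g) := by rw [← Real.exp_add]; push_cast; ring_nf

/-- Kato's inequality: for `{0,1}`-valued random variables `χ^(1), …, χ^(n)` adapted to a
filtration, with `S_n = Σ_i E[χ^(i) | F^(i−1)]` and `N_n = Σ_i χ^(i)`, for any `a ∈ ℝ` and
`b ≥ |a|`,
`Pr[S_n ≥ N_n + (b + a(2N_n/n − 1))√n] ≤ exp(−(2b² − 2a²)/(1 + 4a/(3√n))²)`. -/
theorem kato_inequality
    {Ω : Type*} {m0 : MeasurableSpace Ω} (μ : Measure Ω) [IsProbabilityMeasure μ]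
    (n : ℕ) (hn : 0 < n) (ℱ : Filtration ℕ m0) (χ : ℕ → Ω → ℝ)
    (hadp : ∀ i, 1 ≤ i → i ≤ n → StronglyMeasurable[ℱ i] (χ i))
    (h01 : ∀ i ω, χ i ω = 0 ∨ χ i ω = 1)
    (a b : ℝ) (hb : |a| ≤ b) :
    μ {ω | (∑ i ∈ Icc 1 n, (μ[χ i | ℱ (i - 1)]) ω) ≥
        (∑ i ∈ Icc 1 n, χ i ω) +
          (b + a * (2 * (∑ i ∈ Icc 1 n, χ i ω) / n - 1)) * Real.sqrt n}
      ≤ ENNReal.ofReal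
          (Real.exp (-(2 * b ^ 2 - 2 * a ^ 2) / (1 + 4 * a / (3 * Real.sqrt n)) ^ 2)) := by
  have hn' : (0 : ℝ) < n := by exact_mod_cast hn
  set r := Real.sqrt n with hr
  have hrpos : 0 < r := Real.sqrt_pos.2 hn'
  have hrn : (n : ℝ) = r ^ 2 := (Real.sq_sqrt hn'.le).symm
  have hkeq : 1 + 4 * a / (3 * r) = 1 + 4 * (a / r) / 3 := by field_simp
  by_cases hk : 1 + 4 * (a / r) / 3 = 0
  · rw [hkeq, hk]
    simpa using prob_le_one
  rw [hkeq]
  set t := 4 * (b / r) / (1 + 4 * (a / r) / 3) ^ 2 with ht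
  have htnn : 0 ≤ t := by
    have : 0 ≤ b := (abs_nonneg a).trans hb
    positivity
  obtain ⟨hint, hle⟩ := integral_exp_sum_condExp_le (μ := μ) hadp h01 (t := t)
    (c := 1 + 2 * (a / r)) (fun p hp => bernoulli_mgf_le (β := b / r) hk ht hp.1 hp.2) n le_rfl
  have hchernoff := ProbabilityTheory.measure_ge_le_exp_mul_mgf ((b - a) * r) htnn hint
  have hset : {ω | (∑ i ∈ Icc 1 n, (μ[χ i | ℱ (i - 1)]) ω) ≥ (∑ i ∈ Icc 1 n, χ i ω) +
        (b + a * (2 * (∑ i ∈ Icc 1 n, χ i ω) / n - 1)) * r} =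
      {ω | (b - a) * r ≤
        ∑ i ∈ Icc 1 n, (μ[χ i | ℱ (i - 1)] ω - (1 + 2 * (a / r)) * χ i ω)} := by
    ext ω
    simp only [Set.mem_ofPred_eq, ge_iff_le]
    rw [Finset.sum_sub_distrib, ← Finset.mul_sum, le_sub_iff_add_le]
    refine iff_of_eq (congrArg (· ≤ _) ?_)
    rw [hrn]
    field_simp
    ring
  rw [hset, ← ofReal_measureReal]
  refine ENNReal.ofReal_le_ofReal (hchernoff.trans ?_)
  refine (mul_le_mul_of_nonneg_left hle (Real.exp_pos _).le).trans_eq ?_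
  rw [← Real.exp_add, ht, hrn]
  congr 1
  have hk' : r * 3 + 4 * a ≠ 0 := fun h => hk (by field_simp; linarith)
  field_simp
  ring
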